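/- Under the uniform local ℓ_p stability assumption and the stated conditions on α and γ, the value function W is continuous on the space of all nonempty compact subsets of ℝ^n equipped with the symmetric Hausdorff distance d_H^s. -/

import Mathlib

open Metric Set Filter Topology TopologicalSpace ENNReal

noncomputable section

abbrev Euc (n : ℕ) : Type := EuclideanSpace ℝ (Fin n)

/-- Trajectory of the discrete-time uncertain system `x_{k+1} = f (x_k) (w_k)`. -/
def traj {n m : ℕ} (f : Euc n → Euc m → Euc n) (x : Euc n) (π : ℕ → Euc m) : ℕ → Euc n
  | 0 => x
  | k + 1 => f (traj f x π k) (π k)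

/-- Reachable set of `X` at time `k` under disturbance signals taking values in `W`. -/
def reach {n m : ℕ} (f : Euc n → Euc m → Euc n) (W : Set (Euc m)) (X : Set (Euc n)) (k : ℕ) :
    Set (Euc n) :=
  {y | ∃ x ∈ X, ∃ π : ℕ → Euc m, (∀ j, π j ∈ W) ∧ y = traj f x π k}

/-- The one-step set-valued map `F(X) = {f x w : x ∈ X, w ∈ W}`. -/
def Fmap {n m : ℕ} (f : Euc n → Euc m → Euc n) (W : Set (Euc m)) (X : Set (Euc n)) :
    Set (Euc n) :=
  Set.image2 f X W

/-- Asymmetric (directed) Hausdorff distance `sup_{x ∈ A} dist(x, B)`. -/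
def dHa {n : ℕ} (A B : Set (Euc n)) : ℝ := ⨆ x : A, Metric.infDist (x : Euc n) B

/-- Uniform local ℓ_p stability of the robust invariant set `𝒜` within the safe set `𝒳`. -/
structure LpStable {n m : ℕ} (f : Euc n → Euc m → Euc n) (W : Set (Euc m))
    (𝒳 𝒜 : Set (Euc n)) where
  r : ℝ
  M : ℝ
  p : ℝ
  lam : ℝ → ℕ → ℝ
  r_pos : 0 < r
  M_ge_one : 1 ≤ M
  p_pos : 0 < p
  lam_nonneg : ∀ s ∈ Set.Icc (0 : ℝ) r, ∀ k : ℕ, 0 ≤ lam s k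
  lam_cont : ∀ k : ℕ, ContinuousOn (fun s => lam s k) (Set.Icc (0 : ℝ) r)
  lam_mono : ∀ k : ℕ, MonotoneOn (fun s => lam s k) (Set.Icc (0 : ℝ) r)
  lam_zero : ∀ k : ℕ, lam 0 k = 0
  lam_anti : ∀ s ∈ Set.Icc (0 : ℝ) r, ∀ k l : ℕ, k ≤ l → lam s l ≤ lam s k
  lam_le_id : ∀ s ∈ Set.Icc (0 : ℝ) r, lam s 0 ≤ s
  lam_summable : Summable fun k : ℕ => lam r k ^ p
  stab : ∀ x ∈ 𝒳, Metric.infDist x 𝒜 ≤ r →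
    ∀ π : ℕ → Euc m, (∀ j, π j ∈ W) →
      ∀ k : ℕ, Metric.infDist (traj f x π k) 𝒜 ≤ M * lam (Metric.infDist x 𝒜) k

/-- The safe robust domain of uniform attraction. -/
def DOUA {n m : ℕ} (f : Euc n → Euc m → Euc n) (W : Set (Euc m)) (𝒳 𝒜 : Set (Euc n)) :
    Set (Euc n) :=
  {x | (∀ k : ℕ, reach f W {x} k ⊆ 𝒳) ∧
    Filter.Tendsto (fun k => dHa (reach f W {x} k) 𝒜) Filter.atTop (nhds 0)}

/-- The safe robust domain of attraction. -/
def DOA {n m : ℕ} (f : Euc n → Euc m → Euc n) (W : Set (Euc m)) (𝒳 𝒜 : Set (Euc n)) :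
    Set (Euc n) :=
  {x | ∀ π : ℕ → Euc m, (∀ j, π j ∈ W) →
    (∀ k : ℕ, traj f x π k ∈ 𝒳) ∧
      Filter.Tendsto (fun k => Metric.infDist (traj f x π k) 𝒜) Filter.atTop (nhds 0)}

/-- `Ψ(X) = (sup_{y∈X} γ y) * (sup_{y∈X} α y)`. -/
def Psi {n : ℕ} (α : Euc n → ℝ) (γ : Euc n → ℝ≥0∞) (X : Set (Euc n)) : ℝ≥0∞ :=
  (⨆ y : X, γ (y : Euc n)) * ENNReal.ofReal (⨆ y : X, α (y : Euc n))

/-- The value function `V(X) = Σ_k Ψ(R(X,k))`. -/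
def Vval {n m : ℕ} (f : Euc n → Euc m → Euc n) (W : Set (Euc m)) (α : Euc n → ℝ)
    (γ : Euc n → ℝ≥0∞) (X : Set (Euc n)) : ℝ≥0∞ :=
  ∑' k : ℕ, Psi α γ (reach f W X k)

/-- `exp(-a)` for `a ∈ [0,∞]`, with `exp(-∞) = 0`. -/
def expNeg (a : ℝ≥0∞) : ℝ := if a = ⊤ then 0 else Real.exp (-a.toReal)

/-- The value function `W(X) = 1 - exp(-V(X))`. -/
def Wval {n m : ℕ} (f : Euc n → Euc m → Euc n) (W : Set (Euc m)) (α : Euc n → ℝ)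
    (γ : Euc n → ℝ≥0∞) (X : Set (Euc n)) : ℝ :=
  1 - expNeg (Vval f W α γ X)

/-- `ξ(X) = 1 - exp(-Ψ(X))`. -/
def xival {n : ℕ} (α : Euc n → ℝ) (γ : Euc n → ℝ≥0∞) (X : Set (Euc n)) : ℝ :=
  1 - expNeg (Psi α γ X)

/-- `β(X) = exp(Ψ(X)) - 1`. -/
def betaval {n : ℕ} (α : Euc n → ℝ) (γ : Euc n → ℝ≥0∞) (X : Set (Euc n)) : ℝ :=
  Real.exp ((Psi α γ X).toReal) - 1

/-- Conditions on `α`: continuous with `α̲ dist(x,𝒜)^p̄ ≤ α(x) ≤ ᾱ dist(x,𝒜)^p̄`. -/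
def AlphaHyp {n : ℕ} (𝒜 : Set (Euc n)) (α : Euc n → ℝ) (αlow αup pbar : ℝ) : Prop :=
  Continuous α ∧ 0 < αlow ∧ αlow ≤ αup ∧
    ∀ x : Euc n, αlow * Metric.infDist x 𝒜 ^ pbar ≤ α x ∧
      α x ≤ αup * Metric.infDist x 𝒜 ^ pbar

/-- Conditions on `γ`: finite, continuous and `≥ γ̲ > 0` on `𝒳`, `= ∞` outside `𝒳`,
blowing up along sequences converging to the boundary of `𝒳`. -/
def GammaHyp {n : ℕ} (𝒳 : Set (Euc n)) (γ : Euc n → ℝ≥0∞) (γlow : ℝ) : Prop :=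
  (∀ x ∈ 𝒳, γ x ≠ ⊤) ∧ ContinuousOn γ 𝒳 ∧ 0 < γlow ∧
    (∀ x ∈ 𝒳, ENNReal.ofReal γlow ≤ γ x) ∧
    (∀ x ∉ 𝒳, γ x = ⊤) ∧
    ∀ (u : ℕ → Euc n) (x : Euc n), x ∈ frontier 𝒳 →
      Filter.Tendsto u Filter.atTop (nhds x) →
      Filter.Tendsto (fun k => γ (u k)) Filter.atTop (nhds ⊤)

theorem expNeg_eq (a : ℝ≥0∞) : expNeg a = (EReal.exp (-(a : EReal))).toReal := by
  unfold expNeg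
  split_ifs with h
  · simp [h]
  · lift a to NNReal using h
    have : ((a : ℝ≥0∞) : EReal) = ((a : ℝ) : EReal) := rfl
    rw [this, ← EReal.coe_neg, EReal.exp_coe, ENNReal.toReal_ofReal (Real.exp_pos _).le]
    simp

theorem continuous_expNeg : Continuous expNeg := by
  have h : expNeg = fun a : ℝ≥0∞ => (EReal.exp (-(a : EReal))).toReal := funext expNeg_eq
  rw [h]
  refine ENNReal.continuousOn_toReal.comp_continuous
    (ENNReal.continuous_exp.comp (continuous_neg.comp continuous_coe_ennreal_ereal)) ?_
  intro a
  simp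

theorem continuous_iSup_compacts {E : Type*} [TopologicalSpace E] (g : E → ℝ≥0∞)
    (hg : Continuous g) :
    Continuous fun K : NonemptyCompacts E => ⨆ y : (K : Set E), g y := by
  rw [continuous_iff_continuousAt]
  intro K
  rw [ContinuousAt, tendsto_order]
  constructor
  · intro a ha
    obtain ⟨y, hy⟩ := lt_iSup_iff.1 ha
    have ho := NonemptyCompacts.isOpen_inter_nonempty_of_isOpen (hg.isOpen_preimage _ (isOpen_Ioi (a := a)))
    filter_upwards [ho.mem_nhds (x := K) ⟨y, y.2, hy⟩] with L hL
    obtain ⟨z, hz, hz'⟩ := hL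
    exact lt_iSup_iff.2 ⟨⟨z, hz⟩, hz'⟩
  · intro b hb
    have ho := NonemptyCompacts.isOpen_subsets_of_isOpen (hg.isOpen_preimage _ (isOpen_Iio (a := b)))
    have hK : (K : Set E) ⊆ g ⁻¹' Iio b := fun y hy =>
      lt_of_le_of_lt (le_iSup (fun y : (K : Set E) => g y) ⟨y, hy⟩) hb
    filter_upwards [ho.mem_nhds (x := K) hK] with L hL
    obtain ⟨z, hz, hmax⟩ := L.isCompact.exists_isMaxOn L.nonempty hg.continuousOn
    exact lt_of_le_of_lt (iSup_le fun y => hmax y.2) (hL hz)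

theorem Psi_eq {n : ℕ} {α : Euc n → ℝ} (hc : Continuous α) (h0 : ∀ x, 0 ≤ α x)
    (γ : Euc n → ℝ≥0∞) (K : NonemptyCompacts (Euc n)) :
    Psi α γ (K : Set (Euc n)) =
      (⨆ y : (K : Set (Euc n)), γ y) * ⨆ y : (K : Set (Euc n)), ENNReal.ofReal (α y) := by
  unfold Psi
  congr 1
  haveI : Nonempty (K : Set (Euc n)) := K.nonempty.to_subtype
  have hb : BddAbove (range fun y : (K : Set (Euc n)) => α y) := by
    have := K.isCompact.bddAbove_image hc.continuousOn
    rwa [image_eq_range] at this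
  apply le_antisymm
  · obtain ⟨z, hz, hmax⟩ := K.isCompact.exists_isMaxOn K.nonempty hc.continuousOn
    refine le_trans (ENNReal.ofReal_le_ofReal (ciSup_le fun y => hmax y.2)) ?_
    exact le_iSup (fun y : (K : Set (Euc n)) => ENNReal.ofReal (α y)) ⟨z, hz⟩
  · exact iSup_le fun y => ENNReal.ofReal_le_ofReal (le_ciSup hb y)

theorem continuous_gamma {n : ℕ} {𝒳 : Set (Euc n)} (h𝒳 : IsOpen 𝒳) {γ : Euc n → ℝ≥0∞} {γlow : ℝ}
    (hγ : GammaHyp 𝒳 γ γlow) : Continuous γ := by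
  obtain ⟨-, h2, -, -, h5, h6⟩ := hγ
  rw [continuous_iff_continuousAt]
  intro x
  by_cases hx : x ∈ 𝒳
  · exact h2.continuousAt (h𝒳.mem_nhds hx)
  by_cases hx' : x ∈ closure 𝒳
  · have hfr : x ∈ frontier 𝒳 := ⟨hx', fun h => hx (interior_subset h)⟩
    rw [ContinuousAt, h5 x hx]
    exact tendsto_of_seq_tendsto fun u hu => h6 u x hfr hu
  · have : γ =ᶠ[𝓝 x] fun _ => ⊤ := by
      filter_upwards [isClosed_closure.isOpen_compl.mem_nhds hx'] with y hy
      exact h5 y fun h => hy (subset_closure h)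
    exact (continuousAt_const).congr this.symm

theorem continuous_Psi {n : ℕ} {𝒳 : Set (Euc n)} (h𝒳 : IsOpen 𝒳) {𝒜 : Set (Euc n)}
    (h𝒜ne : 𝒜.Nonempty) (h𝒜c : IsCompact 𝒜) (h𝒜𝒳 : 𝒜 ⊆ 𝒳)
    {α : Euc n → ℝ} (hc : Continuous α) (h0 : ∀ x, 0 ≤ α x) (hpos : ∀ x, x ∉ 𝒜 → 0 < α x)
    {γ : Euc n → ℝ≥0∞} (hγ : Continuous γ) (hfin : ∀ x ∈ 𝒳, γ x ≠ ⊤) :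
    Continuous fun K : NonemptyCompacts (Euc n) => Psi α γ (K : Set (Euc n)) := by
  simp_rw [Psi_eq hc h0]
  have hα' : Continuous fun y => ENNReal.ofReal (α y) := ENNReal.continuous_ofReal.comp hc
  have key : ∀ K : NonemptyCompacts (Euc n), (⨆ y : (K : Set (Euc n)), γ y) = ⊤ →
      (⨆ y : (K : Set (Euc n)), ENNReal.ofReal (α y)) ≠ 0 := by
    intro K hK h
    obtain ⟨z, hz, hmax⟩ := K.isCompact.exists_isMaxOn K.nonempty hγ.continuousOn
    have hzt : γ z = ⊤ := top_le_iff.1 (hK ▸ iSup_le fun y => hmax y.2)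
    have h1 : ENNReal.ofReal (α z) ≤ 0 :=
      h ▸ le_iSup (fun y : (K : Set (Euc n)) => ENNReal.ofReal (α y)) ⟨z, hz⟩
    have h2 : 0 < ENNReal.ofReal (α z) := ENNReal.ofReal_pos.2
      (hpos z fun hzA => hfin z (h𝒜𝒳 hzA) hzt)
    exact absurd h1 (not_le.2 h2)
  rw [continuous_iff_continuousAt]
  intro K
  refine ENNReal.Tendsto.mul (continuous_iSup_compacts γ hγ).continuousAt ?_
    (continuous_iSup_compacts _ hα').continuousAt ?_
  · by_cases h : (⨆ y : (K : Set (Euc n)), γ y) = ⊤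
    · left; rw [h]; simp
    · right
      obtain ⟨z, hz, hmax⟩ := K.isCompact.exists_isMaxOn K.nonempty hα'.continuousOn
      exact ne_top_of_le_ne_top ENNReal.ofReal_ne_top (iSup_le fun y => hmax y.2)
  · by_cases h : (⨆ y : (K : Set (Euc n)), γ y) = ⊤
    · left; exact key K h
    · right; exact h

theorem continuous_traj {n m : ℕ} {f : Euc n → Euc m → Euc n}
    (hf : Continuous fun p : Euc n × Euc m => f p.1 p.2) (k : ℕ) :
    Continuous fun q : Euc n × (ℕ → Euc m) => traj f q.1 q.2 k := by
  induction k with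
  | zero => exact continuous_fst
  | succ k ih =>
    exact hf.comp (ih.prodMk ((continuous_apply k).comp continuous_snd))

theorem traj_add {n m : ℕ} (f : Euc n → Euc m → Euc n) (x : Euc n) (π : ℕ → Euc m) (N k : ℕ) :
    traj f x π (N + k) = traj f (traj f x π N) (fun j => π (N + j)) k := by
  induction k with
  | zero => rfl
  | succ k ih =>
    rw [← add_assoc]
    simp only [traj, ih]

theorem exists_reachNC {n m : ℕ} {f : Euc n → Euc m → Euc n}
    (hf : Continuous fun p : Euc n × Euc m => f p.1 p.2)
    {Wd : Set (Euc m)} (hWne : Wd.Nonempty) (hWc : IsCompact Wd) (k : ℕ) :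
    ∃ R : NonemptyCompacts (Euc n) → NonemptyCompacts (Euc n), Continuous R ∧
      ∀ K : NonemptyCompacts (Euc n), (R K : Set (Euc n)) = reach f Wd (K : Set (Euc n)) k := by
  let P : NonemptyCompacts (ℕ → Euc m) :=
    ⟨⟨Set.pi univ fun _ => Wd, isCompact_univ_pi fun _ => hWc⟩,
      univ_pi_nonempty_iff.2 fun _ => hWne⟩
  refine ⟨fun K => NonemptyCompacts.map (fun q : Euc n × (ℕ → Euc m) => traj f q.1 q.2 k)
    (continuous_traj hf k) (K ×ˢ P), ?_, ?_⟩
  · exact (Continuous.nonemptyCompacts_map (continuous_traj hf k)).comp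
      (NonemptyCompacts.continuous_prod.comp (continuous_id.prodMk continuous_const))
  · intro K
    ext y
    simp only [NonemptyCompacts.coe_map, NonemptyCompacts.coe_prod, reach, mem_image, mem_prod,
      Prod.exists, mem_setOf_eq]
    constructor
    · rintro ⟨x, π, ⟨hx, hπ⟩, rfl⟩
      exact ⟨x, hx, π, fun j => hπ j (mem_univ _), rfl⟩
    · rintro ⟨x, hx, π, hπ, rfl⟩
      exact ⟨x, π, ⟨hx, fun j _ => hπ j⟩, rfl⟩

theorem tendsto_tsum_dom {X : Type*} {l : Filter X} [l.IsCountablyGenerated]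
    (F : ℕ → X → ℝ≥0∞) (a : ℕ → ℝ≥0∞) (b : ℕ → ℝ≥0∞) (hb : ∑' k, b k ≠ ⊤)
    (h1 : ∀ᶠ x in l, ∀ k, F k x ≤ b k) (h2 : ∀ k, Tendsto (F k) l (𝓝 (a k))) :
    Tendsto (fun x => ∑' k, F k x) l (𝓝 (∑' k, a k)) := by
  simp_rw [← MeasureTheory.lintegral_count]
  refine MeasureTheory.tendsto_lintegral_filter_of_dominated_convergence b ?_ ?_ ?_ ?_
  · exact Eventually.of_forall fun _ => measurable_of_countable _
  · filter_upwards [h1] with x hx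
    exact Eventually.of_forall hx
  · rwa [MeasureTheory.lintegral_count]
  · exact Eventually.of_forall h2

theorem tsum_split (g : ℕ → ℝ≥0∞) (N : ℕ) :
    ∑' k, g k = (∑ k ∈ Finset.range N, g k) + ∑' k, g (N + k) := by
  have h := (ENNReal.summable (f := fun k => g (k + N))).sum_add_tsum_nat_add'
  rw [← h]
  congr 1
  exact tsum_congr fun k => by rw [add_comm]

theorem stmt12 {n m : ℕ}
    (f : Euc n → Euc m → Euc n) (hf : Continuous fun p : Euc n × Euc m => f p.1 p.2)
    (Wd : Set (Euc m)) (hWne : Wd.Nonempty) (hWc : IsCompact Wd)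
    (𝒳 : Set (Euc n)) (h𝒳 : IsOpen 𝒳)
    (𝒜 : Set (Euc n)) (h𝒜ne : 𝒜.Nonempty) (h𝒜c : IsCompact 𝒜) (h𝒜𝒳 : 𝒜 ⊆ 𝒳)
    (h𝒜inv : ∀ x ∈ 𝒜, ∀ w ∈ Wd, f x w ∈ 𝒜)
    (H : LpStable f Wd 𝒳 𝒜)
    (α : Euc n → ℝ) (αlow αup pbar : ℝ) (hα : AlphaHyp 𝒜 α αlow αup pbar)
    (hpbar : H.p ≤ pbar)
    (γ : Euc n → ℝ≥0∞) (γlow : ℝ) (hγ : GammaHyp 𝒳 γ γlow)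
    : Continuous fun K : NonemptyCompacts (Euc n) => Wval f Wd α γ (K : Set (Euc n)) := by
  have hγc : Continuous γ := continuous_gamma h𝒳 hγ
  obtain ⟨hαc, hαl, hαlu, hαb⟩ := hα
  obtain ⟨hγfin, -, hγl, hγge, hγtop, -⟩ := hγ
  have hpb : 0 < pbar := lt_of_lt_of_le H.p_pos hpbar
  have hαu : 0 < αup := lt_of_lt_of_le hαl hαlu
  have hα0 : ∀ x, 0 ≤ α x := fun x =>
    le_trans (mul_nonneg hαl.le (Real.rpow_nonneg infDist_nonneg _)) (hαb x).1
  have hαpos : ∀ x, x ∉ 𝒜 → 0 < α x := by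
    intro x hx
    have hd : 0 < infDist x 𝒜 := (h𝒜c.isClosed.notMem_iff_infDist_pos h𝒜ne).1 hx
    exact lt_of_lt_of_le (mul_pos hαl (Real.rpow_pos_of_pos hd _)) (hαb x).1
  have hΨ := continuous_Psi h𝒳 h𝒜ne h𝒜c h𝒜𝒳 hαc hα0 hαpos hγc hγfin
  choose R hRc hR using fun k => exists_reachNC hf hWne hWc k
  have hterm : ∀ k, Continuous fun K : NonemptyCompacts (Euc n) =>
      Psi α γ (reach f Wd (K : Set (Euc n)) k) := by
    intro k
    simp_rw [← hR]
    exact hΨ.comp (hRc k)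
  suffices hV : Continuous fun K : NonemptyCompacts (Euc n) => Vval f Wd α γ (K : Set (Euc n)) from
    continuous_const.sub (continuous_expNeg.comp hV)
  have hM : 0 < H.M := lt_of_lt_of_le one_pos H.M_ge_one
  -- safe neighbourhood
  obtain ⟨δ, hδ, hδs⟩ := h𝒜c.exists_cthickening_subset_open h𝒳 h𝒜𝒳
  have hBc : IsCompact (cthickening δ 𝒜) := h𝒜c.cthickening
  have hBne : (cthickening δ 𝒜).Nonempty := h𝒜ne.mono (self_subset_cthickening _)
  obtain ⟨z, hz, hzmax⟩ := hBc.exists_isMaxOn hBne hγc.continuousOn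
  have hzt : γ z ≠ ⊤ := hγfin z (hδs hz)
  have hmemB : ∀ y, infDist y 𝒜 ≤ δ → y ∈ cthickening δ 𝒜 := by
    intro y hy
    rw [mem_cthickening_iff, ← ENNReal.ofReal_toReal (infEDist_ne_top h𝒜ne)]
    exact ENNReal.ofReal_le_ofReal hy
  set r' : ℝ := min H.r (δ / H.M) with hr'
  have hr'pos : 0 < r' := lt_min H.r_pos (div_pos hδ hM)
  have hr'r : r' ≤ H.r := min_le_left _ _
  have hMr' : H.M * r' ≤ δ := by
    have := mul_le_mul_of_nonneg_left (min_le_right H.r (δ / H.M)) hM.le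
    rwa [mul_div_cancel₀ _ hM.ne'] at this
  have hr'δ : r' ≤ δ := le_trans (by nlinarith [H.M_ge_one]) hMr'
  have hrr : H.r ∈ Icc (0:ℝ) H.r := ⟨H.r_pos.le, le_rfl⟩
  have hlr0 : ∀ k, 0 ≤ H.lam H.r k := H.lam_nonneg _ hrr
  rw [continuous_iff_continuousAt]
  intro K
  by_cases hK : Vval f Wd α γ (K : Set (Euc n)) = ⊤
  · have hl : LowerSemicontinuous fun K : NonemptyCompacts (Euc n) =>
        ∑' k, Psi α γ (reach f Wd (K : Set (Euc n)) k) :=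
      lowerSemicontinuous_tsum fun k => (hterm k).lowerSemicontinuous
    rw [ContinuousAt, hK, tendsto_order]
    refine ⟨fun a ha => ?_, fun a ha => absurd ha (not_lt.2 le_top)⟩
    exact hl K a (by rw [← hK] at ha; exact ha)
  -- finite case
  have hpt : 0 < γlow * (αlow * r' ^ pbar) :=
    mul_pos hγl (mul_pos hαl (Real.rpow_pos_of_pos hr'pos _))
  have htz := ENNReal.tendsto_atTop_zero_of_tsum_ne_top hK
  obtain ⟨N, hN⟩ := ((tendsto_order.1 htz).2 _ (ENNReal.ofReal_pos.2 hpt)).exists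
  have hKN : (R N K : Set (Euc n)) ⊆ {y | infDist y 𝒜 < r'} := by
    intro y hy
    by_contra hcon
    rw [mem_setOf_eq, not_lt] at hcon
    refine absurd hN (not_lt.2 ?_)
    rw [← hR, Psi_eq hαc hα0, ENNReal.ofReal_mul hγl.le]
    refine mul_le_mul' ?_ ?_
    · refine le_trans ?_ (le_iSup (fun y : (R N K : Set (Euc n)) => γ y) ⟨y, hy⟩)
      by_cases hyX : y ∈ 𝒳
      · exact hγge y hyX
      · simp [hγtop y hyX]
    · refine le_trans ?_
        (le_iSup (fun y : (R N K : Set (Euc n)) => ENNReal.ofReal (α y)) ⟨y, hy⟩)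
      refine ENNReal.ofReal_le_ofReal (le_trans ?_ (hαb y).1)
      exact mul_le_mul_of_nonneg_left (Real.rpow_le_rpow hr'pos.le hcon hpb.le) hαl.le
  have hopen : IsOpen {y : Euc n | infDist y 𝒜 < r'} :=
    isOpen_lt (continuous_infDist_pt 𝒜) continuous_const
  have hev : ∀ᶠ Y in 𝓝 K, (R N Y : Set (Euc n)) ⊆ {y | infDist y 𝒜 < r'} :=
    (hRc N).continuousAt.eventually
      ((NonemptyCompacts.isOpen_subsets_of_isOpen hopen).mem_nhds hKN)
  let C : ℝ := αup * (H.M ^ pbar * H.r ^ (pbar - H.p))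
  let b : ℕ → ℝ≥0∞ := fun k => γ z * ENNReal.ofReal (C * H.lam H.r k ^ H.p)
  have hb : ∑' k, b k ≠ ⊤ := by
    rw [ENNReal.tsum_mul_left]
    exact ENNReal.mul_ne_top hzt (H.lam_summable.mul_left C).tsum_ofReal_ne_top
  have hdom : ∀ᶠ Y in 𝓝 K, ∀ k, Psi α γ (reach f Wd ((Y : NonemptyCompacts (Euc n)) :
      Set (Euc n)) (N + k)) ≤ b k := by
    filter_upwards [hev] with Y hY k
    rw [← hR, Psi_eq hαc hα0]
    have hdist : ∀ y ∈ (R (N + k) Y : Set (Euc n)),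
        infDist y 𝒜 ≤ δ ∧ infDist y 𝒜 ≤ H.M * H.lam H.r k := by
      intro y hy
      rw [hR] at hy
      obtain ⟨x, hx, π, hπ, rfl⟩ := hy
      have hd : infDist (traj f x π N) 𝒜 < r' := hY (by rw [hR]; exact ⟨x, hx, π, hπ, rfl⟩)
      have hdI : infDist (traj f x π N) 𝒜 ∈ Icc (0:ℝ) H.r :=
        ⟨infDist_nonneg, hd.le.trans hr'r⟩
      have hs := H.stab (traj f x π N) (hδs (hmemB _ (hd.le.trans hr'δ))) hdI.2
        (fun j => π (N + j)) (fun j => hπ _) k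
      rw [← traj_add] at hs
      refine ⟨hs.trans (le_trans (mul_le_mul_of_nonneg_left ?_ hM.le) hMr'),
        hs.trans (mul_le_mul_of_nonneg_left (H.lam_mono k hdI hrr hdI.2) hM.le)⟩
      exact (H.lam_anti _ hdI 0 k (Nat.zero_le _)).trans ((H.lam_le_id _ hdI).trans hd.le)
    refine mul_le_mul' (iSup_le fun y => ?_) (iSup_le fun y => ?_)
    · exact hzmax (hmemB _ (hdist y y.2).1)
    · refine ENNReal.ofReal_le_ofReal ((hαb y).2.trans ?_)
      have hlr : H.lam H.r k ≤ H.r :=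
        (H.lam_anti _ hrr 0 k (Nat.zero_le _)).trans (H.lam_le_id _ hrr)
      have e1 : infDist (y : Euc n) 𝒜 ^ pbar ≤ H.M ^ pbar * H.lam H.r k ^ pbar := by
        rw [← Real.mul_rpow hM.le (hlr0 k)]
        exact Real.rpow_le_rpow infDist_nonneg (hdist y y.2).2 hpb.le
      have e2 : H.lam H.r k ^ pbar ≤ H.r ^ (pbar - H.p) * H.lam H.r k ^ H.p := by
        have : pbar = (pbar - H.p) + H.p := by ring
        conv_lhs => rw [this]
        rw [Real.rpow_add_of_nonneg (hlr0 k) (sub_nonneg.2 hpbar) H.p_pos.le]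
        exact mul_le_mul_of_nonneg_right
          (Real.rpow_le_rpow (hlr0 k) hlr (sub_nonneg.2 hpbar)) (Real.rpow_nonneg (hlr0 k) _)
      have e3 := mul_le_mul_of_nonneg_left e2 (Real.rpow_nonneg hM.le pbar)
      calc αup * infDist (y : Euc n) 𝒜 ^ pbar
          ≤ αup * (H.M ^ pbar * (H.r ^ (pbar - H.p) * H.lam H.r k ^ H.p)) :=
            mul_le_mul_of_nonneg_left (e1.trans e3) hαu.le
        _ = C * H.lam H.r k ^ H.p := by simp only [C]; ring
  have hsplit : (fun Y : NonemptyCompacts (Euc n) => Vval f Wd α γ (Y : Set (Euc n))) =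
      fun Y : NonemptyCompacts (Euc n) =>
      (∑ k ∈ Finset.range N, Psi α γ (reach f Wd (Y : Set (Euc n)) k)) +
        ∑' k, Psi α γ (reach f Wd (Y : Set (Euc n)) (N + k)) :=
    funext fun Y => tsum_split _ N
  rw [hsplit]
  refine ContinuousAt.add (continuous_finsetSum _ fun k _ => hterm k).continuousAt ?_
  exact tendsto_tsum_dom (fun k (Y : NonemptyCompacts (Euc n)) =>
    Psi α γ (reach f Wd (Y : Set (Euc n)) (N + k))) _ b hb hdom
    fun k => (hterm (N + k)).continuousAt

end
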